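/- arXiv:1706.00851 — 2 statements merged into one kernel-verified Lean document; each statement's English description precedes it below -/
import Mathlib

section
/- Let d ≥ 2 and let G be a finite simple d-regular graph with n vertices whose adjacency matrix A is a real symmetric matrix with eigenvalues μ_0, μ_1, …, μ_{n−1} (listed with multiplicity). For every k ≥ 2, Tr(A_k) = Σ_{i=0}^{n−1} [ (√(d−1))^k · U_k( μ_i/(2√(d−1)) ) − (√(d−1))^{k−2} · U_{k−2}( μ_i/(2√(d−1)) ) ]. -/
variable {V : Type*}

/-- `f : Fin (k+1) → V` is a walk of length `k` in `G`: consecutive vertices are adjacent. -/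
def IsWalkFun (G : SimpleGraph V) (k : ℕ) (f : Fin (k + 1) → V) : Prop :=
  ∀ i : ℕ, ∀ h : i < k, G.Adj (f ⟨i, by omega⟩) (f ⟨i + 1, by omega⟩)

/-- The walk is non-backtracking: `v_{i-1} ≠ v_{i+1}` for `1 ≤ i ≤ k-1`. -/
def IsNonBacktracking (k : ℕ) (f : Fin (k + 1) → V) : Prop :=
  ∀ i : ℕ, 1 ≤ i → ∀ h : i < k, f ⟨i - 1, by omega⟩ ≠ f ⟨i + 1, by omega⟩

/-- A closed non-backtracking walk of length `k` (possibly with a "tail", i.e. no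
condition relating `v_1` and `v_{k-1}`). -/
def IsClosedNBWalk (G : SimpleGraph V) (k : ℕ) (f : Fin (k + 1) → V) : Prop :=
  IsWalkFun G k f ∧ IsNonBacktracking k f ∧ f (Fin.last k) = f 0

/-- A rooted non-backtracking cycle of length `k`: a closed non-backtracking walk
with the extra condition `v_1 ≠ v_{k-1}`. -/
def IsNBCycle (G : SimpleGraph V) (k : ℕ) (f : Fin (k + 1) → V) : Prop :=
  IsClosedNBWalk G k f ∧ f ⟨1 % (k + 1), Nat.mod_lt 1 k.succ_pos⟩ ≠ f ⟨k - 1, by omega⟩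

/-- `N_k`: the number of rooted non-backtracking cycles of length `k` in `G`. -/
noncomputable def nbCycleCount (G : SimpleGraph V) (k : ℕ) : ℕ :=
  Nat.card { f : Fin (k + 1) → V // IsNBCycle G k f }

/-- `M_k`: the number of closed non-backtracking walks of length `k` in `G`. -/
noncomputable def closedNBWalkCount (G : SimpleGraph V) (k : ℕ) : ℕ :=
  Nat.card { f : Fin (k + 1) → V // IsClosedNBWalk G k f }

/-- `A_k`: the integer matrix whose `(v, w)` entry is the number of non-backtracking
walks of length `k` in `G` from `v` to `w`. -/
noncomputable def nbWalkMatrix (G : SimpleGraph V) [Fintype V] (k : ℕ) : Matrix V V ℤ :=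
  Matrix.of fun v w =>
    (Nat.card { f : Fin (k + 1) → V //
      IsWalkFun G k f ∧ IsNonBacktracking k f ∧ f 0 = v ∧ f (Fin.last k) = w } : ℤ)

/-- `A_k` regarded as a real matrix. -/
noncomputable def nbWalkMatrixR (G : SimpleGraph V) [Fintype V] (k : ℕ) : Matrix V V ℝ :=
  Matrix.of fun v w =>
    (Nat.card { f : Fin (k + 1) → V //
      IsWalkFun G k f ∧ IsNonBacktracking k f ∧ f 0 = v ∧ f (Fin.last k) = w } : ℝ)

theorem isWalkFun_cons_iff (G : SimpleGraph V) (k : ℕ) (x : V) (f : Fin (k + 1) → V) :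
    IsWalkFun G (k + 1) (Fin.cons x f : Fin (k + 2) → V) ↔ G.Adj x (f 0) ∧ IsWalkFun G k f := by
  constructor
  · intro h
    exact ⟨h 0 k.succ_pos, fun i hi => h (i + 1) (by omega)⟩
  · rintro ⟨h0, h⟩ i hi
    cases i with
    | zero => exact h0
    | succ i => exact h i (by omega)

theorem isNonBacktracking_cons_iff (k : ℕ) (x : V) (f : Fin (k + 2) → V) :
    IsNonBacktracking (k + 2) (Fin.cons x f : Fin (k + 3) → V) ↔
      x ≠ f 1 ∧ IsNonBacktracking (k + 1) f := by
  constructor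
  · intro h
    refine ⟨h 1 le_rfl (Nat.succ_lt_succ k.succ_pos), fun i h1 hi => ?_⟩
    obtain ⟨i, rfl⟩ : ∃ j, i = j + 1 := ⟨i - 1, by omega⟩
    exact h (i + 2) (by omega) (by omega)
  · rintro ⟨h0, h⟩ i h1 hi
    match i, h1 with
    | 1, _ => exact h0
    | i + 2, _ => exact h (i + 1) (by omega) (by omega)

/-- The number of non-backtracking walks of length `k + 1` from `x` to `w` whose second vertex
is `v`. -/
noncomputable def nbWalkCountVia (G : SimpleGraph V) (k : ℕ) (x v w : V) : ℕ :=
  Nat.card { f : Fin (k + 2) → V // IsWalkFun G (k + 1) f ∧ IsNonBacktracking (k + 1) f ∧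
    f 0 = x ∧ f 1 = v ∧ f (Fin.last (k + 1)) = w }

theorem nbWalkCountVia_of_not_adj (G : SimpleGraph V) (k : ℕ) {x v : V} (h : ¬ G.Adj x v) (w : V) :
    nbWalkCountVia G k x v w = 0 := by
  refine Nat.card_eq_zero.mpr (Or.inl ⟨?_⟩)
  rintro ⟨f, hw, -, rfl, rfl, -⟩
  exact h (hw 0 (by omega))

theorem nbWalkCountVia_zero [DecidableEq V] (G : SimpleGraph V) (x v w : V) (h : G.Adj x v) :
    nbWalkCountVia G 0 x v w = if v = w then 1 else 0 := by
  unfold nbWalkCountVia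
  split_ifs with hvw
  · subst hvw
    rw [Nat.card_eq_one_iff_exists]
    refine ⟨⟨![x, v], ?_, ?_, rfl, rfl, rfl⟩, ?_⟩
    · intro i hi
      obtain rfl : i = 0 := by omega
      exact h
    · intro i h1 hi
      omega
    · rintro ⟨f, -, -, h0, h1, -⟩
      ext i
      fin_cases i
      · exact h0
      · exact h1
  · refine Nat.card_eq_zero.mpr (Or.inl ⟨?_⟩)
    rintro ⟨f, -, -, -, h1, h2⟩
    exact hvw (h1.symm.trans h2)

/-- A non-backtracking walk from `v` either extends to one starting `x, v` or has second vertex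
`x`. -/
theorem nbWalkMatrixR_succ_apply_eq_add [Fintype V] (G : SimpleGraph V) (k : ℕ) {x v : V}
    (h : G.Adj x v) (w : V) :
    nbWalkMatrixR G (k + 1) v w =
      (nbWalkCountVia G (k + 1) x v w : ℝ) + nbWalkCountVia G k v x w := by
  classical
  have hcons : nbWalkCountVia G (k + 1) x v w =
      Nat.card { f : Fin (k + 2) → V // (IsWalkFun G (k + 1) f ∧ IsNonBacktracking (k + 1) f ∧
        f 0 = v ∧ f (Fin.last (k + 1)) = w) ∧ ¬ f 1 = x } := by
    symm
    refine Nat.card_congr ⟨fun f => ⟨Fin.cons x f.1, ?_⟩, fun f => ⟨Fin.tail f.1, ?_⟩, ?_, ?_⟩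
    · obtain ⟨f, ⟨hw, hb, h0, hl⟩, h1⟩ := f
      exact ⟨(isWalkFun_cons_iff G _ _ _).2 ⟨h0 ▸ h, hw⟩,
        (isNonBacktracking_cons_iff _ _ _).2 ⟨Ne.symm h1, hb⟩, rfl, h0, hl⟩
    · obtain ⟨f, hw, hb, h0, h1, hl⟩ := f
      rw [← Fin.cons_self_tail f] at hw hb
      obtain ⟨-, hw⟩ := (isWalkFun_cons_iff G _ _ _).1 hw
      obtain ⟨hn, hb⟩ := (isNonBacktracking_cons_iff _ _ _).1 hb
      exact ⟨⟨hw, hb, h1, hl⟩, fun hx => hn (h0.trans hx.symm)⟩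
    · intro f
      rfl
    · rintro ⟨f, -, -, h0, -, -⟩
      subst h0
      exact Subtype.ext (Fin.cons_self_tail f)
  rw [add_comm (nbWalkCountVia G (k + 1) x v w : ℝ), hcons, nbWalkMatrixR, Matrix.of_apply,
    ← Nat.cast_add, Nat.cast_inj]
  simp only [nbWalkCountVia, Nat.card_eq_fintype_card, Fintype.card_subtype]
  rw [← Finset.card_filter_add_card_filter_not (s := Finset.filter
      (fun f : Fin (k + 2) → V => IsWalkFun G (k + 1) f ∧ IsNonBacktracking (k + 1) f ∧
        f 0 = v ∧ f (Fin.last (k + 1)) = w) Finset.univ) (fun f => f 1 = x),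
    Finset.filter_filter, Finset.filter_filter]
  congr 2
  ext f
  simp only [Finset.mem_filter, Finset.mem_univ, true_and]
  tauto

section Counting

variable [Fintype V] [DecidableEq V] (G : SimpleGraph V) [DecidableRel G.Adj]

theorem nbWalkMatrixR_succ_apply (k : ℕ) (v w : V) :
    nbWalkMatrixR G (k + 1) v w =
      ∑ u ∈ G.neighborFinset v, (nbWalkCountVia G k v u w : ℝ) := by
  classical
  have hsum : ∑ u ∈ G.neighborFinset v, (nbWalkCountVia G k v u w : ℝ) =
      ∑ u, (nbWalkCountVia G k v u w : ℝ) := by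
    refine Finset.sum_subset (Finset.subset_univ _) fun u _ hu => ?_
    rw [SimpleGraph.mem_neighborFinset] at hu
    rw [nbWalkCountVia_of_not_adj G k hu, Nat.cast_zero]
  rw [hsum, nbWalkMatrixR, Matrix.of_apply, ← Nat.cast_sum, Nat.cast_inj]
  simp only [nbWalkCountVia, Nat.card_eq_fintype_card, Fintype.card_subtype]
  rw [Finset.card_eq_sum_card_fiberwise (f := fun f : Fin (k + 2) → V => f 1)
    (t := Finset.univ) (by intro _ _; simp)]
  refine Finset.sum_congr rfl fun u _ => congrArg Finset.card ?_
  ext f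
  simp only [Finset.mem_filter, Finset.mem_univ, true_and]
  tauto

theorem nbWalkMatrixR_one : nbWalkMatrixR G 1 = G.adjMatrix ℝ := by
  ext v w
  rw [nbWalkMatrixR_succ_apply, SimpleGraph.adjMatrix_apply,
    Finset.sum_congr rfl fun u hu => by
      rw [nbWalkCountVia_zero G v u w ((G.mem_neighborFinset v u).1 hu)]]
  simp

theorem nbWalkMatrixR_add_two_apply (k : ℕ) (v w : V) :
    nbWalkMatrixR G (k + 2) v w = (G.adjMatrix ℝ * nbWalkMatrixR G (k + 1)) v w -
      ∑ u ∈ G.neighborFinset v, (nbWalkCountVia G k u v w : ℝ) := by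
  rw [nbWalkMatrixR_succ_apply, SimpleGraph.adjMatrix_mul_apply, ← Finset.sum_sub_distrib]
  refine Finset.sum_congr rfl fun u hu => ?_
  rw [nbWalkMatrixR_succ_apply_eq_add G k ((G.mem_neighborFinset v u).1 hu)]
  ring

variable {G} {d : ℕ}

theorem nbWalkMatrixR_two (hreg : G.IsRegularOfDegree d) :
    nbWalkMatrixR G 2 = G.adjMatrix ℝ * G.adjMatrix ℝ - (d : ℝ) • 1 := by
  ext v w
  rw [nbWalkMatrixR_add_two_apply, nbWalkMatrixR_one, Matrix.sub_apply, Matrix.smul_apply,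
    Matrix.one_apply, Finset.sum_congr rfl fun u hu => by
      rw [nbWalkCountVia_zero G u v w ((G.mem_neighborFinset v u).1 hu).symm]]
  simp [hreg v]

/-- The three-term recurrence of the non-backtracking walk matrices of a regular graph. -/
theorem nbWalkMatrixR_add_three (hreg : G.IsRegularOfDegree d) (k : ℕ) :
    nbWalkMatrixR G (k + 3) = G.adjMatrix ℝ * nbWalkMatrixR G (k + 2) -
      ((d : ℝ) - 1) • nbWalkMatrixR G (k + 1) := by
  ext v w
  have hsum : ∑ u ∈ G.neighborFinset v, (nbWalkCountVia G (k + 1) u v w : ℝ) =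
      ∑ u ∈ G.neighborFinset v,
        (nbWalkMatrixR G (k + 1) v w - (nbWalkCountVia G k v u w : ℝ)) := by
    refine Finset.sum_congr rfl fun u hu => ?_
    rw [nbWalkMatrixR_succ_apply_eq_add G k ((G.mem_neighborFinset v u).1 hu).symm]
    ring
  rw [nbWalkMatrixR_add_two_apply, hsum, Finset.sum_sub_distrib, ← nbWalkMatrixR_succ_apply,
    Finset.sum_const, SimpleGraph.card_neighborFinset_eq_degree, hreg v, nsmul_eq_mul,
    Matrix.sub_apply, Matrix.smul_apply, smul_eq_mul]
  ring

end Counting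

open Polynomial in
/-- The trace of a polynomial in a real symmetric matrix is the sum of the values of the
polynomial at the roots of the characteristic polynomial. -/
theorem Matrix.IsHermitian.trace_aeval_eq_sum_eval [Fintype V] [DecidableEq V]
    {A : Matrix V V ℝ} (hA : A.IsHermitian) {ι : Type*} [Fintype ι] (μ : ι → ℝ)
    (hμ : A.charpoly = ∏ i, (X - C (μ i))) (p : ℝ[X]) :
    (aeval A p).trace = ∑ i, p.eval (μ i) := by
  have hroots : (Finset.univ.val.map μ : Multiset ℝ) = Finset.univ.val.map hA.eigenvalues := by
    have h := hA.roots_charpoly_eq_eigenvalues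
    rw [hμ, Finset.prod_eq_multiset_prod, ← Function.comp_def (fun a => X - C a) μ,
      ← Multiset.map_map (fun a => X - C a) μ, roots_multiset_prod_X_sub_C] at h
    exact h
  have hsum : ∑ i, p.eval (μ i) = ∑ v, p.eval (hA.eigenvalues v) := by
    have h := congrArg (fun s : Multiset ℝ => (s.map fun x => p.eval x).sum) hroots
    simp only [Multiset.map_map] at h
    exact h
  have hdiag : aeval (Matrix.diagonal hA.eigenvalues) p =
      Matrix.diagonal fun v => p.eval (hA.eigenvalues v) := by
    have h := aeval_algHom_apply (Matrix.diagonalAlgHom ℝ (n := V) (α := ℝ)) hA.eigenvalues p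
    simp only [Matrix.diagonalAlgHom_apply] at h
    rw [h]
    congr 1
    ext v
    simp
  have hspec := hA.spectral_theorem
  conv_lhs => rw [hspec]
  rw [aeval_algHom_apply, hsum]
  have hofReal : (RCLike.ofReal ∘ hA.eigenvalues : V → ℝ) = hA.eigenvalues := rfl
  rw [hofReal, hdiag, Unitary.conjStarAlgAut_apply, Matrix.trace_mul_comm, ← mul_assoc]
  simp [Matrix.trace_diagonal]

open Polynomial in
/-- The rescaled Chebyshev polynomial `s ^ k * U k (X / (2 * s))`. -/
noncomputable def scaledChebyshevU (s : ℝ) (k : ℕ) : ℝ[X] :=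
  C (s ^ k) * (Chebyshev.U ℝ (k : ℤ)).comp (C (2 * s)⁻¹ * X)

open Polynomial in
theorem scaledChebyshevU_zero (s : ℝ) : scaledChebyshevU s 0 = 1 := by
  simp [scaledChebyshevU]

open Polynomial in
theorem scaledChebyshevU_add_two {s : ℝ} (hs : s ≠ 0) (k : ℕ) :
    scaledChebyshevU s (k + 2) =
      X * scaledChebyshevU s (k + 1) - C (s ^ 2) * scaledChebyshevU s k := by
  have hC : C s * (2 * C (2 * s)⁻¹) = (1 : ℝ[X]) := by
    rw [show (2 : ℝ[X]) = C 2 from rfl, ← C_mul, ← C_mul, ← C_1]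
    congr 1
    field_simp
  simp only [scaledChebyshevU, Nat.cast_add, Nat.cast_ofNat, Nat.cast_one, Chebyshev.U_add_two,
    sub_comp, mul_comp, X_comp, ofNat_comp, C_pow, Nat.cast_ofNat]
  linear_combination (C s ^ (k + 1) * X *
    (Chebyshev.U ℝ ((k : ℤ) + 1)).comp (C (2 * s)⁻¹ * X)) * hC

open Polynomial in
theorem scaledChebyshevU_one {s : ℝ} (hs : s ≠ 0) : scaledChebyshevU s 1 = X := by
  have hC : s * (2 * (2 * s)⁻¹) = 1 := by field_simp
  simp only [scaledChebyshevU, Nat.cast_one, Chebyshev.U_one, mul_comp, X_comp, ofNat_comp,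
    pow_one]
  rw [show ((2 : ℕ) : ℝ[X]) = C 2 from rfl, ← mul_assoc, ← mul_assoc, ← C_mul, ← C_mul, mul_assoc,
    hC, C_1, one_mul]

open Polynomial in
theorem nbWalkMatrixR_eq_aeval [Fintype V] [DecidableEq V] {G : SimpleGraph V}
    [DecidableRel G.Adj] {d : ℕ} (hreg : G.IsRegularOfDegree d) {s : ℝ} (hs : s ≠ 0)
    (hsd : s ^ 2 = (d : ℝ) - 1) (k : ℕ) :
    nbWalkMatrixR G (k + 2) =
      aeval (G.adjMatrix ℝ) (scaledChebyshevU s (k + 2) - scaledChebyshevU s k) := by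
  have hrec (m : ℕ) : scaledChebyshevU s (m + 2) =
      X * scaledChebyshevU s (m + 1) - C ((d : ℝ) - 1) * scaledChebyshevU s m := by
    rw [scaledChebyshevU_add_two hs, hsd]
  have haeval (p q : ℝ[X]) : G.adjMatrix ℝ * aeval (G.adjMatrix ℝ) p -
      ((d : ℝ) - 1) • aeval (G.adjMatrix ℝ) q =
        aeval (G.adjMatrix ℝ) (X * p - C ((d : ℝ) - 1) * q) := by
    rw [map_sub, map_mul, map_mul, aeval_X, aeval_C, Algebra.smul_def]
  have h2 : nbWalkMatrixR G 2 =
      aeval (G.adjMatrix ℝ) (scaledChebyshevU s 2 - scaledChebyshevU s 0) := by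
    have hp : scaledChebyshevU s 2 - scaledChebyshevU s 0 = X * X - C (d : ℝ) := by
      rw [hrec 0, zero_add, scaledChebyshevU_one hs, scaledChebyshevU_zero, C_sub, C_1]
      ring
    rw [nbWalkMatrixR_two hreg, hp, map_sub, map_mul, aeval_X, aeval_C,
      Algebra.algebraMap_eq_smul_one]
  induction k using Nat.twoStepInduction with
  | zero => exact h2
  | one =>
    have h1 : nbWalkMatrixR G 1 = aeval (G.adjMatrix ℝ) (scaledChebyshevU s 1) := by
      rw [nbWalkMatrixR_one, scaledChebyshevU_one hs, aeval_X]
    rw [nbWalkMatrixR_add_three hreg, zero_add, zero_add, h2, h1, haeval]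
    congr 1
    linear_combination scaledChebyshevU_one hs - X * scaledChebyshevU_zero s - hrec 1
  | more k ih₀ ih₁ =>
    rw [nbWalkMatrixR_add_three hreg, ih₀, ih₁, haeval]
    congr 1
    linear_combination hrec k - hrec (k + 2)

open Polynomial in
theorem trace_nbWalkMatrix_eq_sum_chebyshevU (G : SimpleGraph V) [Fintype V] [DecidableEq V]
    [DecidableRel G.Adj] (d : ℕ) (hd : 2 ≤ d) (hreg : G.IsRegularOfDegree d)
    (n : ℕ) (hn : Fintype.card V = n) (μ : Fin n → ℝ)
    (hμ : (G.adjMatrix ℝ).charpoly = ∏ i : Fin n, (Polynomial.X - Polynomial.C (μ i)))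
    (k : ℕ) (hk : 2 ≤ k) :
    (nbWalkMatrixR G k).trace =
      ∑ i : Fin n,
        ((Real.sqrt ((d : ℝ) - 1)) ^ k *
            Polynomial.eval (μ i / (2 * Real.sqrt ((d : ℝ) - 1))) (Polynomial.Chebyshev.U ℝ (k : ℤ))
          - (Real.sqrt ((d : ℝ) - 1)) ^ (k - 2) *
            Polynomial.eval (μ i / (2 * Real.sqrt ((d : ℝ) - 1)))
              (Polynomial.Chebyshev.U ℝ ((k : ℤ) - 2))) := by
  obtain ⟨k, rfl⟩ : ∃ m, k = m + 2 := ⟨k - 2, by omega⟩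
  have hpos : (0 : ℝ) < (d : ℝ) - 1 := by
    have : (2 : ℝ) ≤ d := by exact_mod_cast hd
    linarith
  have hA : (G.adjMatrix ℝ).IsHermitian := by
    rw [Matrix.IsHermitian, Matrix.conjTranspose_eq_transpose_of_trivial]
    exact G.transpose_adjMatrix
  rw [nbWalkMatrixR_eq_aeval hreg (Real.sqrt_ne_zero'.mpr hpos) (Real.sq_sqrt hpos.le) k,
    hA.trace_aeval_eq_sum_eval μ hμ]
  refine Finset.sum_congr rfl fun i _ => ?_
  simp [scaledChebyshevU, div_eq_inv_mul]
end

section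
/- Let d ≥ 2 and let G be a finite simple d-regular graph. Fix k ≥ 3 and r ≥ 1 with k − 2r ≥ 3. The number of closed walks v_0, v_1, …, v_k in G with v_0 = v_k that are non-backtracking as walks (v_{i−1} ≠ v_{i+1} for 1 ≤ i ≤ k−1) and have tail of length exactly r — meaning v_i = v_{k−i} for all 1 ≤ i ≤ r and v_{r+1} ≠ v_{k−r−1} — equals (d−2)(d−1)^{r−1} · N_{k−2r}. -/
variable {V : Type*}

/-- A closed non-backtracking walk of length `k` whose tail has length exactly `r`. -/
def IsTailedNBWalk (G : SimpleGraph V) (k r : ℕ) (hrk : r < k) (f : Fin (k + 1) → V) : Prop :=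
  IsClosedNBWalk G k f ∧
    (∀ i : ℕ, 1 ≤ i → ∀ h : i ≤ r, f ⟨i, by omega⟩ = f ⟨k - i, by omega⟩) ∧
    f ⟨r + 1, by omega⟩ ≠ f ⟨k - r - 1, by omega⟩

/-- Drop the first and the last vertex of a walk. -/
def trimEnds {k : ℕ} (f : Fin (k + 2 + 1) → V) : Fin (k + 1) → V :=
  fun i => f ⟨i + 1, by omega⟩

/-- Add the vertex `v` at both ends of a walk. -/
def extendEnds {k : ℕ} (g : Fin (k + 1) → V) (v : V) : Fin (k + 2 + 1) → V :=
  fun i => if h : 1 ≤ (i : ℕ) ∧ (i : ℕ) ≤ k + 1 then g ⟨i - 1, by omega⟩ else v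

theorem trimEnds_extendEnds {k : ℕ} (g : Fin (k + 1) → V) (v : V) :
    trimEnds (extendEnds g v) = g := by
  funext i
  have := i.isLt
  simp only [trimEnds, extendEnds]
  rw [dif_pos (by omega)]
  rfl

theorem extendEnds_zero {k : ℕ} (g : Fin (k + 1) → V) (v : V) : extendEnds g v 0 = v := by
  simp [extendEnds]

theorem extendEnds_last {k : ℕ} (g : Fin (k + 1) → V) (v : V) :
    extendEnds g v (Fin.last (k + 2)) = v := by
  simp [extendEnds]

theorem extendEnds_trimEnds {k : ℕ} (f : Fin (k + 2 + 1) → V) (hf : f (Fin.last (k + 2)) = f 0) :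
    extendEnds (trimEnds f) (f 0) = f := by
  funext i
  simp only [trimEnds, extendEnds]
  split_ifs with h
  · congr 1
    ext
    simp only
    omega
  · rcases Nat.eq_zero_or_pos (i : ℕ) with h0 | h0
    · congr 1
      ext
      simp [h0]
    · rw [← hf]
      congr 1
      ext
      have := i.isLt
      simp only [Fin.val_last]
      omega

/-- The vertices that can be added at both ends of a closed walk `g` so that it stays
non-backtracking. -/
def IsEndExtension (G : SimpleGraph V) (k : ℕ) (hk : 1 ≤ k) (g : Fin (k + 1) → V) (v : V) : Prop :=
  G.Adj (g 0) v ∧ v ≠ g ⟨1, by omega⟩ ∧ v ≠ g ⟨k - 1, by omega⟩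

theorem isTailedNBWalk_add_two_iff (G : SimpleGraph V) {k r : ℕ} (hrk : r < k)
    (f : Fin (k + 2 + 1) → V) :
    IsTailedNBWalk G (k + 2) (r + 1) (by omega) f ↔
      IsTailedNBWalk G k r hrk (trimEnds f) ∧ f (Fin.last (k + 2)) = f 0 ∧
        IsEndExtension G k (by omega) (trimEnds f) (f 0) := by
  obtain ⟨u, hu⟩ : ∃ u : ℕ → V, ∀ (i : ℕ) (h : i < k + 2 + 1), f ⟨i, h⟩ = u i :=
    ⟨fun i => if h : i < k + 2 + 1 then f ⟨i, h⟩ else f 0, fun i h => by simp [h]⟩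
  have hz : f 0 = u 0 := hu 0 (by omega)
  have hl : f (Fin.last (k + 2)) = u (k + 2) := hu (k + 2) (by omega)
  have hgz : f ⟨((0 : Fin (k + 1)) : ℕ) + 1, by simp⟩ = u 1 := hu 1 (by omega)
  have hgl : f ⟨((Fin.last k : Fin (k + 1)) : ℕ) + 1, by simp⟩ = u (k + 1) := hu (k + 1) (by omega)
  simp only [IsTailedNBWalk, IsClosedNBWalk, IsWalkFun, IsNonBacktracking, IsEndExtension,
    trimEnds, hz, hl, hgz, hgl, hu]
  constructor
  · rintro ⟨⟨hw, hn, hc⟩, ht, he⟩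
    have h1 : u 1 = u (k + 1) := ht 1 le_rfl (by omega)
    refine ⟨⟨⟨fun i h => hw (i + 1) (by omega), fun i hi h => ?_, h1.symm⟩, fun i hi h => ?_, ?_⟩,
      hc, (hw 0 (by omega)).symm, hn 1 le_rfl (by omega), ?_⟩
    · have := hn (i + 1) (by omega) (by omega)
      rwa [show i + 1 - 1 = i - 1 + 1 by omega] at this
    · have := ht (i + 1) (by omega) (by omega)
      rwa [show k + 2 - (i + 1) = k - i + 1 by omega] at this
    · rwa [show k + 2 - (r + 1) - 1 = k - r - 1 + 1 by omega] at he
    · have := hn (k + 1) (by omega) (by omega)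
      rw [show k + 1 - 1 = k - 1 + 1 by omega, show k + 1 + 1 = k + 2 by omega, hc] at this
      exact this.symm
  · rintro ⟨⟨⟨hw, hn, h1⟩, ht, he⟩, hc, ha, hv, hv'⟩
    refine ⟨⟨fun i h => ?_, fun i hi h => ?_, hc⟩, fun i hi h => ?_, ?_⟩
    · rcases Nat.eq_zero_or_pos i with rfl | hi
      · exact ha.symm
      · rcases Nat.lt_or_ge i (k + 1) with hik | hik
        · have := hw (i - 1) (by omega)
          rwa [show i - 1 + 1 = i by omega] at this
        · obtain rfl : i = k + 1 := by omega
          rw [h1, show k + 1 + 1 = k + 2 by omega, hc]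
          exact ha
    · rcases Nat.lt_or_ge 1 i with hi1 | hi1
      · rcases Nat.lt_or_ge i (k + 1) with hik | hik
        · have := hn (i - 1) (by omega) (by omega)
          rwa [show i - 1 - 1 + 1 = i - 1 by omega, show i - 1 + 1 = i by omega] at this
        · obtain rfl : i = k + 1 := by omega
          rw [show k + 1 - 1 = k - 1 + 1 by omega, show k + 1 + 1 = k + 2 by omega, hc]
          exact hv'.symm
      · obtain rfl : i = 1 := by omega
        exact hv
    · rcases Nat.lt_or_ge 1 i with hi1 | hi1
      · have := ht (i - 1) (by omega) (by omega)
        rwa [show i - 1 + 1 = i by omega, show k - (i - 1) + 1 = k + 2 - i by omega] at this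
      · obtain rfl : i = 1 := by omega
        exact h1.symm
    · rwa [show k + 2 - (r + 1) - 1 = k - r - 1 + 1 by omega]

/-- A walk with a tail of length `r + 1` is a walk with a tail of length `r` together with an
admissible new end vertex. -/
def tailedNBWalkEquiv (G : SimpleGraph V) {k r : ℕ} (hrk : r < k) :
    { f : Fin (k + 2 + 1) → V // IsTailedNBWalk G (k + 2) (r + 1) (by omega) f } ≃
      Σ g : { g : Fin (k + 1) → V // IsTailedNBWalk G k r hrk g },
        { v : V // IsEndExtension G k (by omega) g.1 v } where
  toFun f := ⟨⟨trimEnds f.1, ((isTailedNBWalk_add_two_iff G hrk f.1).1 f.2).1⟩,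
    ⟨f.1 0, ((isTailedNBWalk_add_two_iff G hrk f.1).1 f.2).2.2⟩⟩
  invFun p := ⟨extendEnds p.1.1 p.2.1, (isTailedNBWalk_add_two_iff G hrk _).2 (by
    rw [trimEnds_extendEnds, extendEnds_zero, extendEnds_last]
    exact ⟨p.1.2, rfl, p.2.2⟩)⟩
  left_inv f := Subtype.ext (extendEnds_trimEnds f.1 f.2.1.2.2)
  right_inv := by
    rintro ⟨⟨g, hg⟩, ⟨v, hv⟩⟩
    have h1 := trimEnds_extendEnds g v
    have h2 := extendEnds_zero g v
    refine Sigma.subtype_ext (Subtype.ext h1) h2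

theorem card_tailedNBWalk_succ (G : SimpleGraph V) [Finite V] {k r c : ℕ} (hrk : r < k)
    (hc : ∀ g : Fin (k + 1) → V, IsTailedNBWalk G k r hrk g →
      Nat.card { v : V // IsEndExtension G k (by omega) g v } = c) :
    Nat.card { f : Fin (k + 2 + 1) → V // IsTailedNBWalk G (k + 2) (r + 1) (by omega) f } =
      c * Nat.card { g : Fin (k + 1) → V // IsTailedNBWalk G k r hrk g } := by
  have := Fintype.ofFinite { g : Fin (k + 1) → V // IsTailedNBWalk G k r hrk g }
  rw [Nat.card_congr (tailedNBWalkEquiv G hrk), Nat.card_sigma,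
    Finset.sum_congr rfl fun g _ => hc g.1 g.2]
  simp [mul_comm]

theorem card_adj_ne_ne (G : SimpleGraph V) [Fintype V] [DecidableEq V] [DecidableRel G.Adj]
    {d : ℕ} (hreg : G.IsRegularOfDegree d) {x a b : V} (ha : G.Adj x a) (hb : G.Adj x b) :
    Nat.card { v : V // G.Adj x v ∧ v ≠ a ∧ v ≠ b } = d - ({a, b} : Finset V).card := by
  rw [← hreg x, ← G.card_neighborFinset_eq_degree, ← Finset.card_sdiff_of_subset,
    Nat.card_eq_fintype_card, Fintype.card_subtype]
  · congr 1
    ext v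
    simp
  · intro v
    simp only [Finset.mem_insert, Finset.mem_singleton, SimpleGraph.mem_neighborFinset]
    rintro (rfl | rfl) <;> assumption

theorem IsClosedNBWalk.adj_zero {G : SimpleGraph V} {k : ℕ} {g : Fin (k + 1) → V}
    (hg : IsClosedNBWalk G k g) (hk : 1 ≤ k) :
    G.Adj (g 0) (g ⟨1, by omega⟩) ∧ G.Adj (g 0) (g ⟨k - 1, by omega⟩) := by
  obtain ⟨hw, -, hc⟩ := hg
  refine ⟨hw 0 hk, ?_⟩
  have h := hw (k - 1) (by omega)
  have he : (⟨k - 1 + 1, by omega⟩ : Fin (k + 1)) = Fin.last k := by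
    ext
    simp only [Fin.val_last]
    omega
  rw [he, hc] at h
  exact h.symm

theorem isTailedNBWalk_zero_iff (G : SimpleGraph V) {k : ℕ} (hk : 0 < k) (f : Fin (k + 1) → V) :
    IsTailedNBWalk G k 0 hk f ↔ IsNBCycle G k f := by
  have h1 : (⟨1 % (k + 1), Nat.mod_lt 1 k.succ_pos⟩ : Fin (k + 1)) = ⟨1, by omega⟩ := by
    ext
    exact Nat.mod_eq_of_lt (by omega)
  simp only [IsTailedNBWalk, IsNBCycle, h1]
  refine and_congr_right fun _ => ⟨fun h => h.2, fun h => ⟨fun i hi h' => ?_, h⟩⟩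
  omega

theorem card_tailedNBWalk (G : SimpleGraph V) [Fintype V] [DecidableRel G.Adj] {d : ℕ}
    (hreg : G.IsRegularOfDegree d) {m : ℕ} (hm : 0 < m) (r : ℕ) :
    Nat.card { f : Fin (m + 2 * (r + 1) + 1) → V //
        IsTailedNBWalk G (m + 2 * (r + 1)) (r + 1) (by omega) f } =
      (d - 2) * (d - 1) ^ r * nbCycleCount G m := by
  classical
  induction r with
  | zero =>
    have := card_tailedNBWalk_succ G (c := d - 2) hm fun g hg => by
      have hadj := hg.1.adj_zero hm
      have hne : g ⟨1, by omega⟩ ≠ g ⟨m - 1, by omega⟩ := hg.2.2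
      rw [← Finset.card_pair hne]
      exact card_adj_ne_ne G hreg hadj.1 hadj.2
    simp only [isTailedNBWalk_zero_iff] at this
    simpa [nbCycleCount] using this
  | succ r ih =>
    have := card_tailedNBWalk_succ G (c := d - 1) (k := m + 2 * (r + 1)) (r := r + 1) (by omega)
      fun g hg => by
        have hadj := hg.1.adj_zero (by omega)
        have heq := hg.2.1 1 le_rfl (by omega)
        have hcard : ({g ⟨1, by omega⟩, g ⟨m + 2 * (r + 1) - 1, by omega⟩} : Finset V).card = 1 := by
          rw [heq, Finset.pair_eq_singleton, Finset.card_singleton]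
        exact (card_adj_ne_ne G hreg hadj.1 hadj.2).trans (congrArg (d - ·) hcard)
    rw [ih] at this
    refine this.trans ?_
    ring

theorem count_tailed_walks_with_tail_length (G : SimpleGraph V) [Fintype V]
    [DecidableRel G.Adj] (d : ℕ) (hd : 2 ≤ d) (hreg : G.IsRegularOfDegree d)
    (k r : ℕ) (hk : 3 ≤ k) (hr : 1 ≤ r) (hkr : 3 ≤ k - 2 * r) :
    Nat.card { f : Fin (k + 1) → V // IsClosedNBWalk G k f ∧
        (∀ i : ℕ, 1 ≤ i → ∀ h : i ≤ r, f ⟨i, by omega⟩ = f ⟨k - i, by omega⟩) ∧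
        f ⟨r + 1, by omega⟩ ≠ f ⟨k - r - 1, by omega⟩ } =
      (d - 2) * (d - 1) ^ (r - 1) * nbCycleCount G (k - 2 * r) := by
  obtain ⟨s, rfl⟩ : ∃ s, r = s + 1 := ⟨r - 1, by omega⟩
  obtain ⟨m, rfl⟩ : ∃ m, k = m + 2 * (s + 1) := ⟨k - 2 * (s + 1), by omega⟩
  rw [Nat.add_sub_cancel, Nat.add_sub_cancel]
  exact card_tailedNBWalk G hreg (by omega) s
end
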